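/- Let n ≥ 3 and 0 < λ ≤ Λ, set ñ = (λ/Λ)(n−1) + 1, and let p > 1 satisfy p ≤ ñ/(ñ−2) if ñ > 2 (any p > 1 if ñ ≤ 2). Then there exists a constant C > 0, depending only on n, p, λ, Λ, such that for every R > 0 and every nonnegative u ∈ C²(Ω) on the exterior domain Ω = {x ∈ ℝⁿ : |x| > R} satisfying M⁺_{λ,Λ}(D²u(x)) + u(x)^p = 0 for all x ∈ Ω, one has u(x) + |∇u(x)|^{2/(p+1)} ≤ C · |x|^{−2/(p−1)} for all x with |x| ≥ 2R. -/

import Mathlib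

open scoped BigOperators

/-- The Pucci maximal operator `M⁺_{λ,Λ}`: for a symmetric matrix it equals
`Λ · (sum of positive eigenvalues) + λ · (sum of negative eigenvalues)`. -/
noncomputable def pucciMax (lam Lam : ℝ) {n : ℕ} (M : Matrix (Fin n) (Fin n) ℝ) : ℝ :=
  if h : M.IsHermitian then
    ∑ i, (Lam * max (h.eigenvalues i) 0 + lam * min (h.eigenvalues i) 0)
  else 0

/-- The Hessian matrix of `φ` at `x`. -/
noncomputable def hess {n : ℕ} (φ : EuclideanSpace ℝ (Fin n) → ℝ)
    (x : EuclideanSpace ℝ (Fin n)) : Matrix (Fin n) (Fin n) ℝ :=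
  fun i j => iteratedFDeriv ℝ 2 φ x ![EuclideanSpace.single i 1, EuclideanSpace.single j 1]

open Filter Topology Real
open scoped RealInnerProductSpace

/-- Second-order necessary condition for a local minimum in one variable. -/
lemma second_deriv_nonneg_of_isLocalMin {g g' : ℝ → ℝ} {c : ℝ}
    (hg : ∀ᶠ t in 𝓝 0, HasDerivAt g (g' t) t) (hg' : HasDerivAt g' c 0)
    (hmin : IsLocalMin g 0) : 0 ≤ c := by
  by_contra! hc
  have hd : deriv g =ᶠ[𝓝 0] g' := hg.mono fun t ht => ht.deriv
  have h2 : HasDerivAt (deriv g) c 0 := hg'.congr_of_eventuallyEq hd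
  have hmax : IsLocalMax g 0 :=
    isLocalMax_of_deriv_deriv_neg (by rwa [h2.deriv]) hmin.deriv_eq_zero
      hg.self_of_nhds.continuousAt
  have hconst : g =ᶠ[𝓝 0] fun _ => g 0 := by
    filter_upwards [hmin, hmax] with t h1 h2 using le_antisymm h2 h1
  have h0 : deriv g =ᶠ[𝓝 0] fun _ => 0 := by
    filter_upwards [hconst.deriv] with t ht
    rw [ht, deriv_const]
  have := h2.unique ((hasDerivAt_const (0 : ℝ) (0 : ℝ)).congr_of_eventuallyEq h0)
  exact hc.ne this

lemma Matrix.IsHermitian.dotProduct_mulVec_eq_sum {n : ℕ} {M : Matrix (Fin n) (Fin n) ℝ}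
    (hM : M.IsHermitian) (w : EuclideanSpace ℝ (Fin n)) :
    w.ofLp ⬝ᵥ M.mulVec w.ofLp = ∑ i, hM.eigenvalues i * ⟪hM.eigenvectorBasis i, w⟫ ^ 2 := by
  have hw : w.ofLp = ∑ i, ⟪hM.eigenvectorBasis i, w⟫ • (hM.eigenvectorBasis i).ofLp := by
    conv_lhs => rw [← hM.eigenvectorBasis.sum_repr' w]
    simp
  have hin : ∀ i, w.ofLp ⬝ᵥ (hM.eigenvectorBasis i).ofLp = ⟪hM.eigenvectorBasis i, w⟫ := by
    intro i
    simp [EuclideanSpace.inner_eq_star_dotProduct]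
  conv_lhs => rw [hw, Matrix.mulVec_sum, ← hw]
  rw [dotProduct_sum]
  refine Finset.sum_congr rfl fun i _ => ?_
  rw [Matrix.mulVec_smul, hM.mulVec_eigenvectorBasis, dotProduct_smul, dotProduct_smul, hin]
  simp only [smul_eq_mul]
  ring

/-- The Pucci operator dominates every linear operator with coefficients in `[lam, Lam]`. -/
lemma sum_mul_dotProduct_le_pucciMax {n : ℕ} {M : Matrix (Fin n) (Fin n) ℝ}
    (hM : M.IsHermitian) {lam Lam : ℝ} (b : OrthonormalBasis (Fin n) ℝ (EuclideanSpace ℝ (Fin n)))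
    {a : Fin n → ℝ} (ha : ∀ j, lam ≤ a j ∧ a j ≤ Lam) :
    ∑ j, a j * ((b j).ofLp ⬝ᵥ M.mulVec (b j).ofLp) ≤ pucciMax lam Lam M := by
  rw [pucciMax, dif_pos hM]
  simp_rw [hM.dotProduct_mulVec_eq_sum, Finset.mul_sum]
  rw [Finset.sum_comm]
  refine Finset.sum_le_sum fun i _ => ?_
  have hone : ∑ j, ⟪hM.eigenvectorBasis i, b j⟫ ^ 2 = 1 := by
    have := b.sum_sq_norm_inner_left (hM.eigenvectorBasis i)
    simpa using this
  have hlow : lam ≤ ∑ j, a j * ⟪hM.eigenvectorBasis i, b j⟫ ^ 2 := by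
    calc lam = ∑ j, lam * ⟪hM.eigenvectorBasis i, b j⟫ ^ 2 := by
          rw [← Finset.mul_sum, hone, mul_one]
      _ ≤ _ := Finset.sum_le_sum fun j _ =>
          mul_le_mul_of_nonneg_right (ha j).1 (sq_nonneg _)
  have hupp : ∑ j, a j * ⟪hM.eigenvectorBasis i, b j⟫ ^ 2 ≤ Lam := by
    calc _ ≤ ∑ j, Lam * ⟪hM.eigenvectorBasis i, b j⟫ ^ 2 := Finset.sum_le_sum fun j _ =>
          mul_le_mul_of_nonneg_right (ha j).2 (sq_nonneg _)
      _ = Lam := by rw [← Finset.mul_sum, hone, mul_one]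
  have hsum : ∑ j, a j * (hM.eigenvalues i * ⟪hM.eigenvectorBasis i, b j⟫ ^ 2)
      = hM.eigenvalues i * ∑ j, a j * ⟪hM.eigenvectorBasis i, b j⟫ ^ 2 := by
    rw [Finset.mul_sum]
    exact Finset.sum_congr rfl fun j _ => by ring
  rw [hsum]
  rcases le_total 0 (hM.eigenvalues i) with h | h
  · rw [max_eq_left h, min_eq_right h]
    nlinarith
  · rw [max_eq_right h, min_eq_left h]
    nlinarith

lemma hess_apply {n : ℕ} (u : EuclideanSpace ℝ (Fin n) → ℝ) (x : EuclideanSpace ℝ (Fin n))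
    (i j : Fin n) : hess u x i j =
      fderiv ℝ (fderiv ℝ u) x (EuclideanSpace.single i 1) (EuclideanSpace.single j 1) := by
  simp [hess, iteratedFDeriv_two_apply]

lemma hess_isHermitian {n : ℕ} {u : EuclideanSpace ℝ (Fin n) → ℝ}
    {x : EuclideanSpace ℝ (Fin n)} (hu : ContDiffAt ℝ 2 u x) : (hess u x).IsHermitian := by
  ext i j
  have hs : IsSymmSndFDerivAt ℝ u x := hu.isSymmSndFDerivAt (by simp)
  simp only [Matrix.conjTranspose_apply, hess_apply, star_trivial]
  exact hs.eq _ _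

lemma dotProduct_hess_mulVec {n : ℕ} (u : EuclideanSpace ℝ (Fin n) → ℝ)
    (x w : EuclideanSpace ℝ (Fin n)) :
    w.ofLp ⬝ᵥ (hess u x).mulVec w.ofLp = fderiv ℝ (fderiv ℝ u) x w w := by
  have hw : w = ∑ i, w i • EuclideanSpace.single i (1 : ℝ) := by
    conv_lhs => rw [← (EuclideanSpace.basisFun (Fin n) ℝ).sum_repr w]
    simp
  have : fderiv ℝ (fderiv ℝ u) x w w = fderiv ℝ (fderiv ℝ u) x
      (∑ i, w i • EuclideanSpace.single i (1 : ℝ)) (∑ i, w i • EuclideanSpace.single i (1 : ℝ)) := by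
    rw [← hw]
  rw [this]
  simp only [dotProduct, Matrix.mulVec, hess_apply, map_sum, map_smul,
    _root_.sum_apply, _root_.smul_apply, smul_eq_mul, Finset.mul_sum]
  rw [Finset.sum_comm]
  refine Finset.sum_congr rfl fun i _ => Finset.sum_congr rfl fun j _ => by ring

/-- Second-order condition along the direction `v` where a radial function written in the
variable `log ‖x - x₀‖ ^ 2` touches `u` from below. -/
lemma snd_fderiv_ge_of_isLocalMin_sub_radial {E : Type*} [NormedAddCommGroup E]
    [InnerProductSpace ℝ E] {u : E → ℝ} {z x₀ v : E}
    (hu : ContDiffAt ℝ 2 u z) (hz : z - x₀ ≠ 0) {F F' F'' : ℝ → ℝ}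
    (hF : ∀ τ, HasDerivAt F (F' τ) τ) (hF' : ∀ τ, HasDerivAt F' (F'' τ) τ)
    (hmin : IsLocalMin (fun x => u x - F (log (‖x - x₀‖ ^ 2))) z) :
    F'' (log (‖z - x₀‖ ^ 2)) * (2 * ⟪z - x₀, v⟫ / ‖z - x₀‖ ^ 2) ^ 2
      + F' (log (‖z - x₀‖ ^ 2)) *
        (2 * ‖v‖ ^ 2 / ‖z - x₀‖ ^ 2 - (2 * ⟪z - x₀, v⟫ / ‖z - x₀‖ ^ 2) ^ 2)
      ≤ fderiv ℝ (fderiv ℝ u) z v v := by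
  set y := z - x₀ with hy
  have hy0 : 0 < ‖y‖ ^ 2 := by positivity
  obtain ⟨N, hN⟩ : ∃ N : ℝ → ℝ, N = fun t => ‖y‖ ^ 2 + 2 * t * ⟪y, v⟫ + t ^ 2 * ‖v‖ ^ 2 :=
    ⟨_, rfl⟩
  obtain ⟨N', hN'⟩ : ∃ N' : ℝ → ℝ, N' = fun t => 2 * ⟪y, v⟫ + 2 * t * ‖v‖ ^ 2 := ⟨_, rfl⟩
  have hNnorm : ∀ t : ℝ, ‖z + t • v - x₀‖ ^ 2 = N t := by
    intro t
    rw [show z + t • v - x₀ = y + t • v by rw [hy]; abel, norm_add_sq_real, inner_smul_right,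
      norm_smul, mul_pow, Real.norm_eq_abs, sq_abs]
    simp only [hN]
    ring
  have hNd : ∀ t, HasDerivAt N (N' t) t := by
    intro t
    have := (((hasDerivAt_id t).const_mul 2).mul_const ⟪y, v⟫).const_add (‖y‖ ^ 2) |>.add
      (((hasDerivAt_id t).pow 2).mul_const (‖v‖ ^ 2))
    rw [hN]
    refine this.congr_deriv ?_
    simp [hN']
  have hN'd : HasDerivAt N' (2 * ‖v‖ ^ 2) 0 := by
    have := (((hasDerivAt_id (0 : ℝ)).const_mul 2).mul_const (‖v‖ ^ 2)).const_add (2 * ⟪y, v⟫)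
    rw [hN']
    refine this.congr_deriv ?_
    simp
  have hN0 : N 0 = ‖y‖ ^ 2 := by simp [hN]
  have hN'0 : N' 0 = 2 * ⟪y, v⟫ := by simp [hN']
  have hl : ∀ t, HasDerivAt (fun t : ℝ => z + t • v) v t := by
    intro t
    simpa using ((hasDerivAt_id t).smul_const v).const_add z
  have hlim : Tendsto (fun t : ℝ => z + t • v) (𝓝 0) (𝓝 z) := by
    have := (hl 0).continuousAt.tendsto
    simpa using this
  have hNpos : ∀ᶠ t in 𝓝 (0 : ℝ), N t ≠ 0 :=
    (hNd 0).continuousAt.eventually_ne (by rw [hN0]; exact hy0.ne')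
  have hud : ∀ᶠ x in 𝓝 z, DifferentiableAt ℝ u x :=
    (hu.eventually (by simp)).mono fun x hx => hx.differentiableAt (by simp)
  have h1 : ∀ᶠ t in 𝓝 (0 : ℝ), HasDerivAt (fun t => u (z + t • v) - F (log (N t)))
      (fderiv ℝ u (z + t • v) v - F' (log (N t)) * (N' t / N t)) t := by
    filter_upwards [hNpos, hlim.eventually hud] with t ht hut
    exact (hut.hasFDerivAt.comp_hasDerivAt t (hl t)).sub
      ((hF _).comp t ((hNd t).log ht))
  have hlog0 : HasDerivAt (fun t => log (N t)) (N' 0 / N 0) 0 :=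
    (hNd 0).log (by rw [hN0]; exact hy0.ne')
  have h2 : HasDerivAt (fun t => fderiv ℝ u (z + t • v) v - F' (log (N t)) * (N' t / N t))
      (fderiv ℝ (fderiv ℝ u) z v v - (F'' (log (N 0)) * (N' 0 / N 0) * (N' 0 / N 0)
        + F' (log (N 0)) * ((2 * ‖v‖ ^ 2 * N 0 - N' 0 * N' 0) / N 0 ^ 2))) 0 := by
    refine HasDerivAt.sub ?_ (((hF' _).comp (0 : ℝ) hlog0).mul
      (hN'd.div (hNd 0) (by rw [hN0]; exact hy0.ne')))
    have hd : DifferentiableAt ℝ (fderiv ℝ u) z :=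
      (hu.fderiv_right (m := 1) (by norm_num)).differentiableAt (by simp)
    have hd' : HasFDerivAt (fderiv ℝ u) (fderiv ℝ (fderiv ℝ u) z) (z + (0 : ℝ) • v) := by
      simpa using hd.hasFDerivAt
    have hc : HasDerivAt (fun t : ℝ => fderiv ℝ u (z + t • v)) (fderiv ℝ (fderiv ℝ u) z v) 0 :=
      hd'.comp_hasDerivAt (0 : ℝ) (hl 0)
    exact (hc.clm_apply (hasDerivAt_const (0 : ℝ) v)).congr_deriv (by simp)
  have h3 : IsLocalMin (fun t => u (z + t • v) - F (log (N t))) 0 := by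
    have := hlim.eventually hmin
    filter_upwards [this] with t ht
    simpa [← hNnorm] using ht
  have := second_deriv_nonneg_of_isLocalMin h1 h2 h3
  rw [hN0, hN'0] at this
  have e : (2 * ‖v‖ ^ 2 * ‖y‖ ^ 2 - 2 * ⟪y, v⟫ * (2 * ⟪y, v⟫)) / (‖y‖ ^ 2) ^ 2
      = 2 * ‖v‖ ^ 2 / ‖y‖ ^ 2 - (2 * ⟪y, v⟫ / ‖y‖ ^ 2) ^ 2 := by
    field_simp
  rw [e] at this
  linarith [this]

/-- Comparison of `u` with a radial strict subsolution on an annulus centred at `x₀`. -/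
lemma radial_le_of_pucciMax_lt {n : ℕ} (hn : 1 ≤ n) {lam Lam : ℝ} (hlam : 0 < lam) (hLam : lam ≤ Lam)
    {Ω : Set (EuclideanSpace ℝ (Fin n))} (hΩ : IsOpen Ω) {u : EuclideanSpace ℝ (Fin n) → ℝ}
    (hu : ContDiffOn ℝ 2 u Ω) (x₀ : EuclideanSpace ℝ (Fin n)) {a b : ℝ} (ha : 0 < a)
    (hsub : ∀ x, a ≤ ‖x - x₀‖ → ‖x - x₀‖ ≤ b → x ∈ Ω) {F F' F'' : ℝ → ℝ}
    (hF : ∀ τ, HasDerivAt F (F' τ) τ) (hF' : ∀ τ, HasDerivAt F' (F'' τ) τ)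
    (hbdya : ∀ x, ‖x - x₀‖ = a → F (log (‖x - x₀‖ ^ 2)) ≤ u x)
    (hbdyb : ∀ x, ‖x - x₀‖ = b → F (log (‖x - x₀‖ ^ 2)) ≤ u x)
    (hstrict : ∀ x, a < ‖x - x₀‖ → ‖x - x₀‖ < b → pucciMax lam Lam (hess u x) <
      (Lam * (4 * F'' (log (‖x - x₀‖ ^ 2)) - 2 * F' (log (‖x - x₀‖ ^ 2)))
        + lam * ((n : ℝ) - 1) * (2 * F' (log (‖x - x₀‖ ^ 2)))) / ‖x - x₀‖ ^ 2)
    {x : EuclideanSpace ℝ (Fin n)} (hxa : a ≤ ‖x - x₀‖) (hxb : ‖x - x₀‖ ≤ b) :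
    F (log (‖x - x₀‖ ^ 2)) ≤ u x := by
  set K : Set (EuclideanSpace ℝ (Fin n)) := {x | a ≤ ‖x - x₀‖ ∧ ‖x - x₀‖ ≤ b} with hK
  have hnorm : Continuous fun x : EuclideanSpace ℝ (Fin n) => ‖x - x₀‖ := by fun_prop
  have hKc : IsCompact K := by
    refine (isCompact_closedBall x₀ b).of_isClosed_subset ?_ fun x hx => by
      simpa [dist_eq_norm] using hx.2
    exact (isClosed_le continuous_const hnorm).inter (isClosed_le hnorm continuous_const)
  have hcont : ContinuousOn (fun x => u x - F (log (‖x - x₀‖ ^ 2))) K := by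
    refine (hu.continuousOn.mono fun x hx => hsub x hx.1 hx.2).sub ?_
    have hFc : Continuous F := continuous_iff_continuousAt.2 fun τ => (hF τ).continuousAt
    refine hFc.comp_continuousOn (ContinuousOn.log (by fun_prop) fun x hx => ?_)
    have : 0 < ‖x - x₀‖ := ha.trans_le hx.1
    positivity
  obtain ⟨z, hz, hmin⟩ := hKc.exists_isMinOn ⟨x, hxa, hxb⟩ hcont
  have hxz : u z - F (log (‖z - x₀‖ ^ 2)) ≤ u x - F (log (‖x - x₀‖ ^ 2)) := hmin ⟨hxa, hxb⟩
  by_contra! hneg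
  have hza : a < ‖z - x₀‖ := by
    refine lt_of_le_of_ne hz.1 fun h => ?_
    linarith [hbdya z h.symm]
  have hzb : ‖z - x₀‖ < b := by
    refine lt_of_le_of_ne hz.2 fun h => ?_
    linarith [hbdyb z h]
  have hKn : K ∈ 𝓝 z := by
    have hopen : IsOpen {x : EuclideanSpace ℝ (Fin n) | a < ‖x - x₀‖ ∧ ‖x - x₀‖ < b} :=
      (isOpen_lt continuous_const hnorm).inter (isOpen_lt hnorm continuous_const)
    exact mem_of_superset (hopen.mem_nhds ⟨hza, hzb⟩) fun x hx => ⟨hx.1.le, hx.2.le⟩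
  have hlm := hmin.isLocalMin hKn
  have huz : ContDiffAt ℝ 2 u z := hu.contDiffAt (hΩ.mem_nhds (hsub z hz.1 hz.2))
  set y := z - x₀ with hy
  have hypos : 0 < ‖y‖ := ha.trans hza
  have hy0 : y ≠ 0 := norm_pos_iff.1 hypos
  let i₀ : Fin n := ⟨0, hn⟩
  obtain ⟨bs, hbs⟩ := Orthonormal.exists_orthonormalBasis_extension_of_card_eq (𝕜 := ℝ)
    (E := EuclideanSpace ℝ (Fin n)) (ι := Fin n) (by simp)
    (v := fun _ => (‖y‖⁻¹ : ℝ) • y) (s := {i₀}) (by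
      refine ⟨fun i => ?_, fun i j hij => absurd (Subsingleton.elim i j) hij⟩
      simp [norm_smul, hypos.ne'])
  have hb0 : bs i₀ = (‖y‖⁻¹ : ℝ) • y := hbs i₀ rfl
  have hyin : ∀ j, j ≠ i₀ → ⟪y, bs j⟫ = 0 := by
    intro j hj
    have h1 : ⟪bs i₀, bs j⟫ = 0 := bs.orthonormal.2 hj.symm
    rw [hb0, inner_smul_left] at h1
    simpa [hy0] using h1
  have hyin0 : ⟪y, bs i₀⟫ = ‖y‖ := by
    rw [hb0, inner_smul_right, real_inner_self_eq_norm_sq]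
    field_simp
  have hpuc := sum_mul_dotProduct_le_pucciMax (hess_isHermitian huz) (lam := lam) (Lam := Lam) bs
    (a := fun j => if j = i₀ then Lam else lam) (fun j => by
      by_cases h : j = i₀ <;> simp [h, hLam])
  have hdir : ∀ j, (if j = i₀ then Lam * ((4 * F'' (log (‖y‖ ^ 2)) - 2 * F' (log (‖y‖ ^ 2)))
      / ‖y‖ ^ 2) else lam * (2 * F' (log (‖y‖ ^ 2)) / ‖y‖ ^ 2)) ≤
      (if j = i₀ then Lam else lam) *
        ((bs j).ofLp ⬝ᵥ (hess u z).mulVec (bs j).ofLp) := by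
    intro j
    have h := snd_fderiv_ge_of_isLocalMin_sub_radial (v := bs j) huz hy0 hF hF' hlm
    rw [← hy, bs.norm_eq_one j, ← dotProduct_hess_mulVec] at h
    by_cases hj : j = i₀
    · subst hj
      rw [hyin0] at h
      simp only [if_true]
      refine mul_le_mul_of_nonneg_left (le_trans (le_of_eq ?_) h) (hlam.le.trans hLam)
      field_simp
      ring
    · rw [hyin j hj] at h
      simp only [hj, if_false]
      refine mul_le_mul_of_nonneg_left (le_trans (le_of_eq ?_) h) hlam.le
      field_simp
      ring
  have hsum := (Finset.sum_le_sum fun j _ => hdir j).trans hpuc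
  refine absurd (hstrict z hza hzb) (not_lt.2 (le_trans (le_of_eq ?_) hsum))
  have hite : ∀ (G H : ℝ) (j : Fin n), (if j = i₀ then H else G)
      = G + if j = i₀ then H - G else 0 := by
    intro G H j
    split_ifs <;> ring
  rw [← hy, Finset.sum_congr rfl fun j _ => hite _ _ j, Finset.sum_add_distrib, Finset.sum_ite_eq' Finset.univ i₀]
  simp only [Finset.sum_const, Finset.card_univ, Fintype.card_fin, nsmul_eq_mul,
    Finset.mem_univ, if_true]
  field_simp
  ring

/-- Strong minimum principle for nonnegative supersolutions. -/
lemma pos_of_pucciMax_nonpos {n : ℕ} (hn : 1 ≤ n) {lam Lam : ℝ} (hlam : 0 < lam)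
    (hLam : lam ≤ Lam) {Ω : Set (EuclideanSpace ℝ (Fin n))} (hΩ : IsOpen Ω)
    (hconn : IsPreconnected Ω) {u : EuclideanSpace ℝ (Fin n) → ℝ} (hu : ContDiffOn ℝ 2 u Ω)
    (hnonneg : ∀ x ∈ Ω, 0 ≤ u x) (hsuper : ∀ x ∈ Ω, pucciMax lam Lam (hess u x) ≤ 0)
    (hex : ∃ x ∈ Ω, 0 < u x) : ∀ x ∈ Ω, 0 < u x := by
  have hnpos : (0 : ℝ) < n := by exact_mod_cast hn
  have hPo : IsOpen (Ω ∩ u ⁻¹' Set.Ioi 0) := hu.continuousOn.isOpen_inter_preimage hΩ isOpen_Ioi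
  have hsubset : Ω ⊆ Ω ∩ u ⁻¹' Set.Ioi 0 := by
    obtain ⟨x₁, hx₁, hx₁'⟩ := hex
    refine hconn.subset_of_closure_inter_subset hPo ⟨x₁, hx₁, hx₁, hx₁'⟩ ?_
    rintro z ⟨hzcl, hzΩ⟩
    refine ⟨hzΩ, ?_⟩
    obtain ⟨δ, hδ, hδΩ⟩ := Metric.isOpen_iff.1 hΩ z hzΩ
    obtain ⟨x₀, hx₀, hzx₀⟩ := Metric.mem_closure_iff.1 hzcl (δ / 3) (by positivity)
    obtain ⟨η, hη, hηP⟩ := Metric.isOpen_iff.1 hPo x₀ hx₀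
    rw [dist_eq_norm] at hzx₀
    rcases lt_or_ge ‖z - x₀‖ (η / 2) with hclose | hfar
    · exact (hηP (by rw [Metric.mem_ball, dist_eq_norm]; linarith)).2
    have hball : Metric.closedBall x₀ (η / 2) ⊆ Ω ∩ u ⁻¹' Set.Ioi 0 :=
      (Metric.closedBall_subset_ball (by linarith)).trans hηP
    obtain ⟨w, hw, hwmin⟩ := (isCompact_closedBall x₀ (η / 2)).exists_isMinOn
      ⟨x₀, Metric.mem_closedBall_self (by positivity)⟩
      (hu.continuousOn.mono fun x hx => (hball hx).1)
    have hwpos : 0 < u w := (hball hw).2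
    obtain ⟨c, hc, hcw⟩ : ∃ c : ℝ, 0 < c ∧ c * exp (-n * log ((η / 2) ^ 2)) = u w :=
      ⟨u w / exp (-n * log ((η / 2) ^ 2)), by positivity, by field_simp⟩
    have hd : ∀ τ : ℝ, HasDerivAt (fun τ => exp (-n * τ)) (exp (-n * τ) * (-n)) τ := by
      intro τ
      simpa using ((hasDerivAt_id τ).const_mul (-n : ℝ)).exp
    have hsub : ∀ x : EuclideanSpace ℝ (Fin n), ‖x - x₀‖ ≤ 2 * δ / 3 → x ∈ Ω := by
      intro x hx
      refine hδΩ ?_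
      rw [Metric.mem_ball, dist_eq_norm]
      calc ‖x - z‖ = ‖(x - x₀) - (z - x₀)‖ := by congr 1; abel
        _ ≤ ‖x - x₀‖ + ‖z - x₀‖ := norm_sub_le _ _
        _ < δ := by linarith
    have hcmp := radial_le_of_pucciMax_lt hn hlam hLam hΩ hu x₀ (a := η / 2) (b := 2 * δ / 3)
      (by positivity) (fun x _ hx => hsub x hx)
      (F := fun τ => c * (exp (-n * τ) - exp (-n * log ((2 * δ / 3) ^ 2))))
      (F' := fun τ => c * (exp (-n * τ) * (-n))) (F'' := fun τ => c * (exp (-n * τ) * (-n) * (-n)))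
      (fun τ => ((hd τ).sub_const _).const_mul c) (fun τ => ((hd τ).mul_const _).const_mul c)
      (fun x hx => by
        have h1 : u w ≤ u x := hwmin (by rw [Metric.mem_closedBall, dist_eq_norm, hx])
        rw [hx, mul_sub, hcw]
        have : 0 < c * exp (-n * log ((2 * δ / 3) ^ 2)) := by positivity
        linarith)
      (fun x hx => by
        rw [hx, sub_self, mul_zero]
        exact hnonneg x (hsub x hx.le))
      (fun x hx hx' => by
        refine (hsuper x (hsub x hx'.le)).trans_lt ?_
        have hxp : 0 < ‖x - x₀‖ := lt_trans (by positivity) hx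
        refine div_pos ?_ (by positivity)
        have hE : 0 < c * exp (-n * log (‖x - x₀‖ ^ 2)) := by positivity
        have hk : 0 < Lam * (4 * n ^ 2 + 2 * n) - 2 * lam * (n - 1) * (n : ℝ) := by
          have hL : 0 < Lam := hlam.trans_le hLam
          have : 2 * lam * n ^ 2 ≤ 2 * Lam * (n : ℝ) ^ 2 := by gcongr
          nlinarith [mul_pos hL hnpos, mul_pos hlam hnpos, mul_pos hL (pow_pos hnpos 2)]
        nlinarith [mul_pos hE hk])
      hfar (by linarith)
    have hz : 0 < ‖z - x₀‖ := lt_of_lt_of_le (by positivity) hfar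
    refine lt_of_lt_of_le (mul_pos hc (sub_pos.2 (exp_lt_exp.2 ?_))) hcmp
    have : log (‖z - x₀‖ ^ 2) < log ((2 * δ / 3) ^ 2) :=
      log_lt_log (by positivity) (by gcongr; linarith)
    nlinarith
  exact fun x hx => (hsubset hx).2

lemma isPreconnected_norm_gt {n : ℕ} (hn : 2 ≤ n) {R : ℝ} (hR : 0 < R) :
    IsPreconnected {x : EuclideanSpace ℝ (Fin n) | R < ‖x‖} := by
  have hrank : 1 < Module.rank ℝ (EuclideanSpace ℝ (Fin n)) := by
    rw [← Module.finrank_eq_rank, finrank_euclideanSpace_fin]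
    exact_mod_cast hn
  have h := (isPreconnected_Ioi (a := R)).prod
    (isPreconnected_sphere hrank (0 : EuclideanSpace ℝ (Fin n)) 1)
  convert h.image (fun q : ℝ × EuclideanSpace ℝ (Fin n) => q.1 • q.2) (by fun_prop) using 1
  ext x
  constructor
  · intro hx
    have hx0 : 0 < ‖x‖ := hR.trans hx
    refine ⟨(‖x‖, ‖x‖⁻¹ • x), ⟨hx, by simp [norm_smul, hx0.ne']⟩, by
      simp [smul_smul, hx0.ne']⟩
  · rintro ⟨⟨t, w⟩, ⟨ht, hw⟩, rfl⟩
    have ht' : R < t := ht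
    have hw' : ‖w‖ = 1 := by simpa using hw
    simpa [norm_smul, hw', abs_of_pos (hR.trans ht')] using ht'

/-- Lower bound in an exterior domain by a decaying power times a logarithm. -/
lemma decay_log_le_of_pucciMax {n : ℕ} (hn : 1 ≤ n) {lam Lam : ℝ} (hlam : 0 < lam)
    (hLam : lam ≤ Lam) {R : ℝ} {u : EuclideanSpace ℝ (Fin n) → ℝ}
    (hu : ContDiffOn ℝ 2 u {x | R < ‖x‖}) (hnonneg : ∀ x, R < ‖x‖ → 0 ≤ u x)
    {e s k B : ℝ} (he : 0 < e) (hdim : lam * ((n : ℝ) - 1) ≤ Lam * (e + 1)) (hs : R < exp s)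
    (hk : 0 ≤ k) (hB : 0 ≤ B)
    (hsphere : ∀ x : EuclideanSpace ℝ (Fin n), ‖x‖ = exp s → k * exp (-e * s) ≤ u x)
    (hsuper : ∀ x : EuclideanSpace ℝ (Fin n), exp s < ‖x‖ → pucciMax lam Lam (hess u x) <
      -(Lam * (2 * e + 1) * B * exp (-(e + 2) * log ‖x‖)))
    {x : EuclideanSpace ℝ (Fin n)} (hx : exp s ≤ ‖x‖) :
    (k + B * (log ‖x‖ - s)) * exp (-e * log ‖x‖) ≤ u x := by
  have hΩ : IsOpen {x : EuclideanSpace ℝ (Fin n) | R < ‖x‖} := isOpen_lt continuous_const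
    continuous_norm
  have hL : 0 < Lam := hlam.trans_le hLam
  have hn1 : (1 : ℝ) ≤ n := by exact_mod_cast hn
  have hxpos : 0 < ‖x‖ := (exp_pos s).trans_le hx
  have hE : ∀ τ : ℝ, HasDerivAt (fun τ => exp (-e / 2 * τ)) (exp (-e / 2 * τ) * (-e / 2)) τ := by
    intro τ
    simpa using ((hasDerivAt_id τ).const_mul (-e / 2)).exp
  have hq : ∀ τ : ℝ, HasDerivAt (fun τ => k + B * (τ / 2 - s)) (B / 2) τ := by
    intro τ
    refine ((((hasDerivAt_id τ).div_const 2).sub_const s).const_mul B |>.const_add k).congr_deriv ?_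
    ring
  have hlog2 : ∀ y : EuclideanSpace ℝ (Fin n), log (‖y - 0‖ ^ 2) = 2 * log ‖y‖ := by
    intro y
    rw [sub_zero, log_pow]
    norm_num
  have hkey : ∀ T : ℝ, log ‖x‖ ≤ T →
      (k + B * (log ‖x‖ - s)) * exp (-e * log ‖x‖) - (k + B * (T - s)) * exp (-e * T) ≤ u x := by
    intro T hT
    have hsT : s ≤ T := le_trans ((le_log_iff_exp_le hxpos).2 hx) hT
    have hA : 0 ≤ (k + B * (T - s)) * exp (-e * T) := by
      have := mul_nonneg hB (sub_nonneg.2 hsT)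
      positivity
    have h := radial_le_of_pucciMax_lt hn hlam hLam hΩ hu 0 (a := exp s) (b := exp T) (exp_pos s)
      (fun y hy _ => hs.trans_le (by simpa using hy))
      (F := fun τ => (k + B * (τ / 2 - s)) * exp (-e / 2 * τ) - (k + B * (T - s)) * exp (-e * T))
      (F' := fun τ => B / 2 * exp (-e / 2 * τ)
        + (k + B * (τ / 2 - s)) * (exp (-e / 2 * τ) * (-e / 2)))
      (F'' := fun τ => B / 2 * (exp (-e / 2 * τ) * (-e / 2)) + (B / 2 * (exp (-e / 2 * τ) * (-e / 2))
        + (k + B * (τ / 2 - s)) * (exp (-e / 2 * τ) * (-e / 2) * (-e / 2))))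
      (fun τ => ((hq τ).mul (hE τ)).sub_const _)
      (fun τ => ((hE τ).const_mul _).add ((hq τ).mul ((hE τ).mul_const _)))
      (fun y hy => by
        rw [sub_zero] at hy
        rw [hlog2, hy, log_exp]
        have h1 := hsphere y hy
        have h2 : (k + B * (2 * s / 2 - s)) * exp (-e / 2 * (2 * s)) = k * exp (-e * s) := by
          ring_nf
        rw [h2]
        linarith)
      (fun y hy => by
        rw [sub_zero] at hy
        rw [hlog2, hy, log_exp]
        have h2 : (k + B * (2 * T / 2 - s)) * exp (-e / 2 * (2 * T))
            = (k + B * (T - s)) * exp (-e * T) := by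
          ring_nf
        rw [h2, sub_self]
        exact hnonneg y (hs.trans_le (by rw [hy]; exact exp_le_exp.2 hsT)))
      (fun y hy _ => by
        rw [sub_zero] at hy
        have hypos : 0 < ‖y‖ := (exp_pos s).trans hy
        refine (hsuper y hy).trans_le ?_
        rw [hlog2, sub_zero]
        obtain ⟨σ, hσ⟩ : ∃ σ, ‖y‖ = exp σ := ⟨log ‖y‖, (exp_log hypos).symm⟩
        rw [hσ, log_exp, le_div_iff₀ (by positivity)]
        have hsσ : s ≤ σ := by rw [hσ] at hy; exact (exp_lt_exp.1 hy).le
        have h1 : exp (-(e + 2) * σ) * exp σ ^ 2 = exp (-e * σ) := by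
          rw [← exp_nat_mul, ← exp_add]
          congr 1
          push_cast
          ring
        have h2 : exp (-e / 2 * (2 * σ)) = exp (-e * σ) := by ring_nf
        rw [h2, show (2 * σ / 2 : ℝ) = σ by ring, neg_mul, mul_assoc _ (exp _), h1]
        have hq0 : 0 ≤ k + B * (σ - s) := add_nonneg hk (mul_nonneg hB (sub_nonneg.2 hsσ))
        generalize k + B * (σ - s) = q at *
        have hEp := exp_pos (-e * σ)
        generalize exp (-e * σ) = E at *
        have h3 : 0 ≤ (Lam * (e + 1) - lam * ((n : ℝ) - 1)) * (e * q * E) :=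
          mul_nonneg (by linarith) (by positivity)
        have h4 : 0 ≤ lam * ((n : ℝ) - 1) * (B * E) :=
          mul_nonneg (mul_nonneg hlam.le (by linarith)) (by positivity)
        nlinarith [h3, h4])
      (x := x) (by simpa using hx)
      (by rw [sub_zero]; exact (log_le_iff_le_exp hxpos).1 hT)
    rw [hlog2] at h
    convert h using 3 <;> ring_nf
  have hlim : Tendsto (fun T : ℝ => (k + B * (log ‖x‖ - s)) * exp (-e * log ‖x‖)
      - (k + B * (T - s)) * exp (-e * T)) atTop
      (𝓝 ((k + B * (log ‖x‖ - s)) * exp (-e * log ‖x‖) - 0)) := by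
    refine tendsto_const_nhds.sub ?_
    have hT : Tendsto (fun T : ℝ => e * T) atTop atTop := tendsto_id.const_mul_atTop he
    have h0 := ((tendsto_exp_neg_atTop_nhds_zero.comp hT).const_mul (k - B * s)).add
      (((tendsto_pow_mul_exp_neg_atTop_nhds_zero 1).comp hT).const_mul (B / e))
    rw [mul_zero, mul_zero, add_zero] at h0
    refine h0.congr fun T => ?_
    simp only [Function.comp_apply, pow_one, neg_mul]
    field_simp
    ring
  rw [sub_zero] at hlim
  exact le_of_tendsto hlim (eventually_atTop.2 ⟨log ‖x‖, hkey⟩)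

/-- A positive lower bound for `u` against the critical power doubles after a controlled
logarithmic distance. -/
lemma decay_doubling {n : ℕ} (hn : 1 ≤ n) {lam Lam : ℝ} (hlam : 0 < lam)
    (hLam : lam ≤ Lam) {R p e : ℝ} {u : EuclideanSpace ℝ (Fin n) → ℝ}
    (hu : ContDiffOn ℝ 2 u {x | R < ‖x‖}) (hnonneg : ∀ x, R < ‖x‖ → 0 ≤ u x)
    (hpde : ∀ x, R < ‖x‖ → pucciMax lam Lam (hess u x) + u x ^ p ≤ 0)
    (he : 0 < e) (hdim : lam * ((n : ℝ) - 1) ≤ Lam * (e + 1)) (hp : 1 < p) (hpe : p * e = e + 2)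
    {s k : ℝ} (hs : R < exp s) (hk : 0 < k)
    (hlow : ∀ x : EuclideanSpace ℝ (Fin n), exp s ≤ ‖x‖ → k * exp (-e * log ‖x‖) ≤ u x)
    {x : EuclideanSpace ℝ (Fin n)}
    (hx : exp (s + 2 * Lam * (2 * e + 1) * k ^ (1 - p)) ≤ ‖x‖) :
    2 * k * exp (-e * log ‖x‖) ≤ u x := by
  have hL : 0 < Lam := hlam.trans_le hLam
  have hkp : 0 < k ^ p := rpow_pos_of_pos hk p
  have hkp' : 0 < k ^ (1 - p) := rpow_pos_of_pos hk _
  have hxpos : 0 < ‖x‖ := (exp_pos _).trans_le hx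
  have hδ : 0 ≤ 2 * Lam * (2 * e + 1) * k ^ (1 - p) := by positivity
  have hxs : exp s ≤ ‖x‖ := le_trans (exp_le_exp.2 (by linarith)) hx
  have hB : 0 < k ^ p / (2 * Lam * (2 * e + 1)) := by positivity
  have h := decay_log_le_of_pucciMax hn hlam hLam hu hnonneg he hdim hs hk.le hB.le
    (fun y hy => by simpa [hy] using hlow y hy.ge)
    (fun y hy => by
      have hlow' := hlow y hy.le
      have h1 : (k * exp (-e * log ‖y‖)) ^ p ≤ u y ^ p := by gcongr
      rw [mul_rpow hk.le (exp_pos _).le, ← exp_mul,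
        show -e * log ‖y‖ * p = -(e + 2) * log ‖y‖ by rw [← hpe]; ring] at h1
      have h2 := hpde y (hs.trans hy)
      have h3 : 0 < k ^ p * exp (-(e + 2) * log ‖y‖) := by positivity
      have h4 : Lam * (2 * e + 1) * (k ^ p / (2 * Lam * (2 * e + 1))) = k ^ p / 2 := by
        field_simp
      rw [h4]
      linarith) hxs
  refine le_trans (mul_le_mul_of_nonneg_right ?_ (exp_pos _).le) h
  have h1 : 2 * Lam * (2 * e + 1) * k ^ (1 - p) ≤ log ‖x‖ - s := by
    have := (le_log_iff_exp_le hxpos).2 hx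
    linarith
  have h2 := mul_le_mul_of_nonneg_left h1 hB.le
  have h3 : k ^ p / (2 * Lam * (2 * e + 1)) * (2 * Lam * (2 * e + 1) * k ^ (1 - p)) = k := by
    have : k ^ p * k ^ (1 - p) = k := by rw [← rpow_add hk]; simp
    field_simp
    linarith
  linarith

/-- Nonexistence of positive solutions in exterior domains for subcritical and critical powers. -/
lemma eq_zero_of_pucciMax_add_rpow_nonpos {n : ℕ} (hn : 2 ≤ n) {lam Lam : ℝ} (hlam : 0 < lam)
    (hLam : lam ≤ Lam) {R p e : ℝ} (hR : 0 < R) {u : EuclideanSpace ℝ (Fin n) → ℝ}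
    (hu : ContDiffOn ℝ 2 u {x | R < ‖x‖}) (hnonneg : ∀ x, R < ‖x‖ → 0 ≤ u x)
    (hpde : ∀ x, R < ‖x‖ → pucciMax lam Lam (hess u x) + u x ^ p ≤ 0)
    (he : 0 < e) (hdim : lam * ((n : ℝ) - 1) ≤ Lam * (e + 1)) (hp : 1 < p) (hpe : p * e = e + 2) :
    ∀ x, R < ‖x‖ → u x = 0 := by
  have hn1 : 1 ≤ n := by lia
  have hL : 0 < Lam := hlam.trans_le hLam
  have hnorm : ∀ t : ℝ, ∃ x : EuclideanSpace ℝ (Fin n), ‖x‖ = exp t := fun t =>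
    ⟨EuclideanSpace.single ⟨0, hn1⟩ (exp t), by simp⟩
  by_contra! hne
  have hpos : ∀ x, R < ‖x‖ → 0 < u x := by
    obtain ⟨x₁, hx₁, hx₁'⟩ := hne
    exact pos_of_pucciMax_nonpos hn1 hlam hLam (isOpen_lt continuous_const continuous_norm)
      (isPreconnected_norm_gt hn hR) hu hnonneg
      (fun x hx => by linarith [hpde x hx, rpow_nonneg (hnonneg x hx) p])
      ⟨x₁, hx₁, (hnonneg x₁ hx₁).lt_of_ne' hx₁'⟩
  obtain ⟨s, hs⟩ : ∃ s, R < exp s := ⟨log (R + 1), by rw [exp_log (by linarith)]; linarith⟩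
  obtain ⟨k, hk, hlow⟩ : ∃ k, 0 < k ∧ ∀ x : EuclideanSpace ℝ (Fin n), exp s ≤ ‖x‖ →
      k * exp (-e * log ‖x‖) ≤ u x := by
    obtain ⟨w, hw, hwmin⟩ := (isCompact_sphere (0 : EuclideanSpace ℝ (Fin n)) (exp s)).exists_isMinOn
      (by obtain ⟨x, hx⟩ := hnorm s; exact ⟨x, by simpa using hx⟩)
      (hu.continuousOn.mono fun x hx => by
        have : ‖x‖ = exp s := by simpa using hx
        simpa [this] using hs)
    have hw' : ‖w‖ = exp s := by simpa using hw
    refine ⟨u w * exp (e * s), mul_pos (hpos w (by rwa [hw'])) (exp_pos _), fun x hx => ?_⟩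
    have := decay_log_le_of_pucciMax hn1 hlam hLam hu hnonneg he hdim hs
      (k := u w * exp (e * s)) (B := 0) (mul_pos (hpos w (by rwa [hw'])) (exp_pos _)).le le_rfl
      (fun y hy => by
        rw [mul_assoc, ← exp_add, neg_mul, add_neg_cancel, exp_zero, mul_one]
        exact hwmin (by simpa using hy))
      (fun y hy => by
        have h1 := hpde y (hs.trans hy)
        have h2 := rpow_pos_of_pos (hpos y (hs.trans hy)) p
        simp only [mul_zero, zero_mul, neg_zero]
        linarith) hx
    simpa using this
  set θ : ℝ := 2 ^ (1 - p) with hθ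
  have hθ0 : 0 < θ := rpow_pos_of_pos two_pos _
  have hθ1 : θ < 1 := rpow_lt_one_of_one_lt_of_neg one_lt_two (by linarith)
  obtain ⟨D, hD0, hD⟩ : ∃ D : ℝ, 0 < D ∧ D * (1 - θ) = 2 * Lam * (2 * e + 1) * k ^ (1 - p) := by
    have h1 : 0 < 1 - θ := by linarith
    have := rpow_pos_of_pos hk (1 - p)
    exact ⟨2 * Lam * (2 * e + 1) * k ^ (1 - p) / (1 - θ), by positivity, by field_simp⟩
  have hiter : ∀ j : ℕ, ∀ x : EuclideanSpace ℝ (Fin n), exp (s + D - D * θ ^ j) ≤ ‖x‖ →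
      2 ^ j * k * exp (-e * log ‖x‖) ≤ u x := by
    intro j
    induction j with
    | zero => simpa using hlow
    | succ j ih =>
      intro x hx
      have hθj : θ ^ j ≤ 1 := pow_le_one₀ hθ0.le hθ1.le
      have hkj : (2 ^ j * k) ^ (1 - p) = θ ^ j * k ^ (1 - p) := by
        rw [mul_rpow (by positivity) hk.le, hθ, ← rpow_natCast_mul two_pos.le,
          ← rpow_mul_natCast two_pos.le, mul_comm (j : ℝ)]
      have h := decay_doubling hn1 hlam hLam hu hnonneg hpde he hdim hp hpe
        (s := s + D - D * θ ^ j) (k := 2 ^ j * k)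
        (hs.trans_le (exp_le_exp.2 (by nlinarith))) (by positivity) ih (x := x) (by
          refine le_trans (le_of_eq ?_) hx
          rw [hkj, pow_succ]
          congr 1
          linear_combination -θ ^ j * hD)
      refine le_trans (le_of_eq ?_) h
      ring
  obtain ⟨x, hx⟩ := hnorm (s + D)
  have hc : 0 < k * exp (-e * log ‖x‖) := by positivity
  obtain ⟨j, hj⟩ := pow_unbounded_of_one_lt (u x / (k * exp (-e * log ‖x‖))) one_lt_two
  rw [div_lt_iff₀ hc, ← mul_assoc] at hj
  refine hj.not_ge (hiter j x ?_)
  rw [hx]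
  have := pow_pos hθ0 j
  exact exp_le_exp.2 (by nlinarith)

theorem stmt7 (n : ℕ) (hn : 3 ≤ n) (lam Lam : ℝ) (hlam : 0 < lam) (hLam : lam ≤ Lam)
    (nt : ℝ) (hnt : nt = lam / Lam * ((n : ℝ) - 1) + 1)
    (p : ℝ) (hp : 1 < p)
    (hcrit : 2 < nt → p ≤ nt / (nt - 2)) :
    ∃ C : ℝ, 0 < C ∧
      ∀ R : ℝ, 0 < R →
        ∀ u : EuclideanSpace ℝ (Fin n) → ℝ,
          ContDiffOn ℝ 2 u {x : EuclideanSpace ℝ (Fin n) | R < ‖x‖} →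
          (∀ x : EuclideanSpace ℝ (Fin n), R < ‖x‖ → 0 ≤ u x) →
          (∀ x : EuclideanSpace ℝ (Fin n), R < ‖x‖ →
            pucciMax lam Lam (hess u x) + u x ^ p = 0) →
          ∀ x : EuclideanSpace ℝ (Fin n), 2 * R ≤ ‖x‖ →
            u x + ‖gradient u x‖ ^ (2 / (p + 1)) ≤ C * ‖x‖ ^ (-(2 / (p - 1))) := by
  have hL : 0 < Lam := hlam.trans_le hLam
  have hp1 : 0 < p - 1 := by linarith
  have he : 0 < 2 / (p - 1) := by positivity
  have hdim' : nt - 2 ≤ 2 / (p - 1) := by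
    rcases le_or_gt nt 2 with h | h
    · linarith
    · have h1 := hcrit h
      rw [le_div_iff₀ (by linarith)] at h1
      rw [le_div_iff₀ hp1]
      linarith
  have hdim : lam * ((n : ℝ) - 1) ≤ Lam * (2 / (p - 1) + 1) := by
    have h1 : lam * ((n : ℝ) - 1) = Lam * (nt - 1) := by
      rw [hnt]
      field_simp
      ring
    rw [h1]
    exact mul_le_mul_of_nonneg_left (by linarith) hL.le
  have hpe : p * (2 / (p - 1)) = 2 / (p - 1) + 2 := by
    field_simp
    ring
  refine ⟨1, one_pos, fun R hR u hu hnonneg hpde x hx => ?_⟩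
  have hzero := eq_zero_of_pucciMax_add_rpow_nonpos (by lia : 2 ≤ n) hlam hLam hR hu hnonneg
    (fun y hy => (hpde y hy).le) he hdim hp hpe
  have hxR : R < ‖x‖ := by linarith
  have hev : u =ᶠ[𝓝 x] fun _ => 0 := by
    filter_upwards [(isOpen_lt continuous_const continuous_norm).mem_nhds hxR] with y hy
    exact hzero y hy
  have hgrad : gradient u x = 0 := by
    rw [gradient, hev.fderiv_eq]
    simp
  rw [hzero x hxR, hgrad, norm_zero, zero_rpow (by positivity), add_zero]
  positivity
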